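/- Let n ≥ 3 and a ∈ (2,3]. There exist constants A > 0 and r₀ ∈ (0,1/16] such that the following holds for every r ∈ (0, r₀]. Fix an integer m ≥ 1 and suppose the coefficient functions a_k : {−1,1}^k → [1,a] (with a_0 ≡ 1) have been chosen for k = 0, …, m−2, and that there is a real constant c_{m−1} with c_{m−1} ≤ g̃_{m−1}(x) ≤ c_{m−1} + 2^{−(m−1)} A for all x ∈ K_{m−1}. Then one can choose a_{m−1} : {−1,1}^{m−1} → [1,a] such that there exists a constant c_m with c_m ≤ g̃_m(x) ≤ c_m + 2^{−m} A for all x ∈ K_m. -/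

import Mathlib

open MeasureTheory

noncomputable section

/-- The sign `±1 : ℝ` associated to a boolean letter. -/
def sgn (b : Bool) : ℝ := if b then 1 else -1

/-- `f_m(ε) = Σ_{k=1}^{m} (a_{k−1}(ε)/2) r^{k−1} ε_k` (0-based: sum over `k < m`). -/
def fN (r : ℝ) (A : ℕ → (ℕ → Bool) → ℝ) (m : ℕ) (ε : ℕ → Bool) : ℝ :=
  ∑ k ∈ Finset.range m, A k ε / 2 * r ^ k * sgn (ε k)

/-- A word of length `m` (element of `𝓔_m`), extended to an infinite word by `false`. -/
def extWord (m : ℕ) (σ : Fin m → Bool) : ℕ → Bool :=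
  fun k => if h : k < m then σ ⟨k, h⟩ else false

/-- `C(n) = 𝓗^{n−2}(S^{n−2})`. -/
def sphC (n : ℕ) : ℝ :=
  (μH[(n : ℝ) - 2] (Metric.sphere (0 : EuclideanSpace ℝ (Fin (n - 1))) 1)).toReal

/-- `e_n(t) = e(t,1) = C(n)⁻¹ ∫_{S^{n−2}} (t² + |e₁ − y|²)^{(2−n)/2} d𝓗^{n−2}(y)`. -/
def eFun1 (n : ℕ) (e₁ : EuclideanSpace ℝ (Fin (n - 1))) (t : ℝ) : ℝ :=
  (sphC n)⁻¹ *
    ∫ y in Metric.sphere (0 : EuclideanSpace ℝ (Fin (n - 1))) 1,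
      (t ^ 2 + ‖e₁ - y‖ ^ 2) ^ (((2 : ℝ) - n) / 2) ∂(μH[(n : ℝ) - 2])

/-- The approximate Green function of `E_m = K_m × S^{n−2}`:
`g̃_m(x) = 2^{−m} Σ_{x′ ∈ K_m, x′ ≠ x} e_n(x − x′)`, written on the parameter space `𝓔_m`
(for `x = f_m(σ)`), so `g̃_0 = 0`. -/
def gE (n : ℕ) (e₁ : EuclideanSpace ℝ (Fin (n - 1))) (r : ℝ)
    (A : ℕ → (ℕ → Bool) → ℝ) (m : ℕ) (σ : Fin m → Bool) : ℝ :=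
  (2 : ℝ)⁻¹ ^ m *
    ∑ σ' ∈ Finset.univ.erase σ,
      eFun1 n e₁ (fN r A m (extWord m σ) - fN r A m (extWord m σ'))


section Geo
set_option linter.unusedSectionVars false
open Module
open scoped ENNReal NNReal

variable {E : Type*} [NormedAddCommGroup E] [InnerProductSpace ℝ E] [FiniteDimensional ℝ E]

/-- the orthogonal projection onto the hyperplane orthogonal to `e` -/
def hypP (e : E) : E →L[ℝ] (Submodule.span ℝ {e})ᗮ :=
  (Submodule.span ℝ {e})ᗮ.orthogonalProjectionOnto

lemma hypP_coe (e : E) (he : ‖e‖ = 1) (v : E) :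
    ((hypP e v : (Submodule.span ℝ {e})ᗮ) : E) = v - inner ℝ e v • e := by
  rw [hypP, Submodule.coe_orthogonalProjectionOnto_apply, Submodule.starProjection_orthogonal_val,
    Submodule.starProjection_unit_singleton ℝ he]

lemma hypP_norm_sq (e : E) (he : ‖e‖ = 1) (v : E) :
    ‖hypP e v‖ ^ 2 = ‖v‖ ^ 2 - (inner ℝ e v) ^ 2 := by
  have : ‖hypP e v‖ = ‖v - inner ℝ e v • e‖ := by
    rw [← hypP_coe e he]; rfl
  rw [this, @norm_sub_sq_real, inner_smul_right, real_inner_comm, norm_smul, he]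
  simp only [Real.norm_eq_abs, mul_one, sq_abs]
  ring

lemma hypP_norm_le (e : E) (v : E) : ‖hypP e v‖ ≤ ‖v‖ :=
  Submodule.norm_orthogonalProjectionOnto_apply_le _ _

lemma hypP_self (e : E) (he : ‖e‖ = 1) : hypP e e = 0 := by
  have := hypP_norm_sq e he e
  rw [real_inner_self_eq_norm_sq, he] at this
  simpa using this

/-- the spherical cap -/
def cap (e : E) : Set E := {y | ‖y‖ = 1 ∧ 1 / 2 ≤ inner ℝ e y}

lemma cap_anti (e : E) (he : ‖e‖ = 1) {y z : E} (hy : y ∈ cap e) (hz : z ∈ cap e) :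
    ‖y - z‖ ≤ 3 * ‖hypP e y - hypP e z‖ := by
  obtain ⟨hy1, hy2⟩ := hy
  obtain ⟨hz1, hz2⟩ := hz
  have h0 := hypP_norm_sq e he (y - z)
  have h1 := hypP_norm_sq e he y
  have h2 := hypP_norm_sq e he z
  rw [map_sub, inner_sub_right] at h0
  rw [hy1] at h1
  rw [hz1] at h2
  set p := ‖hypP e y - hypP e z‖
  have hp : 0 ≤ p := norm_nonneg _
  have hyn : ‖hypP e y‖ ≤ 1 := hy1 ▸ hypP_norm_le e y
  have hzn : ‖hypP e z‖ ≤ 1 := hz1 ▸ hypP_norm_le e z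
  have h3 : |‖hypP e y‖ - ‖hypP e z‖| ≤ p := abs_norm_sub_norm_le _ _
  set α := inner ℝ e y
  set β := inner ℝ e z
  have h4 : |α - β| * (α + β) ≤ 2 * p := by
    have : |α - β| * (α + β) = |‖hypP e y‖ - ‖hypP e z‖| * (‖hypP e y‖ + ‖hypP e z‖) := by
      rw [← abs_of_nonneg (show 0 ≤ α + β by linarith), ← abs_mul,
        ← abs_of_nonneg (show 0 ≤ ‖hypP e y‖ + ‖hypP e z‖ by positivity), ← abs_mul,
        ← abs_neg]
      congr 1
      nlinarith
    rw [this]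
    nlinarith [abs_nonneg (‖hypP e y‖ - ‖hypP e z‖), norm_nonneg (hypP e y), norm_nonneg (hypP e z)]
  have h5 : |α - β| ≤ 2 * p := by nlinarith [abs_nonneg (α - β)]
  have h6 : (α - β) ^ 2 ≤ (2 * p) ^ 2 := by
    rw [← sq_abs]; gcongr
  apply le_of_sq_le_sq _ (by positivity)
  nlinarith

lemma cap_hausdorff [MeasurableSpace E] [BorelSpace E] (e : E) (he : ‖e‖ = 1) (d : ℝ) (hd : 0 ≤ d)
    (s : Set E) (hs : s ⊆ cap e) :
    μH[d] s ≤ (3 : ℝ≥0∞) ^ d * μH[d] (hypP e '' s) := by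
  have hinj : Set.InjOn (hypP e) (cap e) := by
    intro y hy z hz h
    have := cap_anti e he hy hz
    rw [h, sub_self, norm_zero, mul_zero] at this
    exact sub_eq_zero.1 (norm_le_zero_iff.1 this)
  set g := Function.invFunOn (hypP e) (cap e)
  have hg : ∀ y ∈ cap e, g (hypP e y) = y := fun y hy => hinj.leftInvOn_invFunOn hy
  have hL : LipschitzOnWith 3 g (hypP e '' s) := by
    apply LipschitzOnWith.of_dist_le_mul
    rintro _ ⟨y, hy, rfl⟩ _ ⟨z, hz, rfl⟩
    rw [hg y (hs hy), hg z (hs hz), dist_eq_norm, dist_eq_norm]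
    exact cap_anti e he (hs hy) (hs hz)
  have := hL.hausdorffMeasure_image_le hd
  have h2 : g '' (hypP e '' s) = s := by
    ext y
    constructor
    · rintro ⟨_, ⟨z, hz, rfl⟩, rfl⟩
      rwa [hg z (hs hz)]
    · intro hy
      exact ⟨_, ⟨y, hy, rfl⟩, hg y (hs hy)⟩
  rw [h2] at this
  simpa using this

lemma hyp_finrank (e : E) (he : ‖e‖ = 1) (d : ℕ) (hd : finrank ℝ E = d + 1) :
    finrank ℝ (Submodule.span ℝ {e})ᗮ = d := by
  have : Fact (finrank ℝ E = d + 1) := ⟨hd⟩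
  exact Submodule.finrank_orthogonal_span_singleton (by rintro rfl; simp at he)

lemma cap_map_le [MeasurableSpace E] [BorelSpace E] (e : E) (he : ‖e‖ = 1) (d : ℝ) (hd : 0 ≤ d) :
    ((μH[d] : Measure E).restrict (cap e)).map (hypP e) ≤
      ((3 : ℝ≥0∞) ^ d) • (μH[d] : Measure (Submodule.span ℝ {e})ᗮ) := by
  refine Measure.le_iff.2 fun B hB => ?_
  have hm : Measurable (hypP e) := (hypP e).continuous.measurable
  rw [Measure.map_apply hm hB, Measure.restrict_apply (hm hB)]
  refine (cap_hausdorff e he d hd _ Set.inter_subset_right).trans ?_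
  rw [Measure.smul_apply, smul_eq_mul]
  gcongr
  rintro _ ⟨y, ⟨hy, -⟩, rfl⟩
  exact hy

/-- integral of the kernel on the cap -/
lemma cap_lintegral [MeasurableSpace E] [BorelSpace E] (e : E) (he : ‖e‖ = 1) (d : ℕ)
    (hd : finrank ℝ E = d + 1) :
    ∃ C : ℝ, 0 ≤ C ∧ ∀ s : ℝ, 0 < s →
      ∫⁻ y in cap e, ENNReal.ofReal ((s ^ 2 + ‖e - y‖ ^ 2) ^ (-((d : ℝ) + 2) / 2)) ∂μH[(d : ℝ)]
        ≤ ENNReal.ofReal (C / s ^ 2) := by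
  have hfr := hyp_finrank e he d hd
  set W := (Submodule.span ℝ {e})ᗮ with hW
  have hH : Measure.IsAddHaarMeasure (μH[(d : ℝ)] : Measure W) := by
    have := @isAddHaarMeasure_hausdorffMeasure W _ _ _ _ _
    rwa [hfr] at this
  have hintg : Integrable (fun x : W => ((1 : ℝ) + ‖x‖ ^ 2) ^ (-((d : ℝ) + 2) / 2)) μH[(d : ℝ)] := by
    apply integrable_rpow_neg_one_add_norm_sq
    rw [hfr]; linarith
  set I := ∫ x : W, ((1 : ℝ) + ‖x‖ ^ 2) ^ (-((d : ℝ) + 2) / 2) ∂μH[(d : ℝ)] with hI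
  have hI0 : 0 ≤ I := integral_nonneg fun x => by positivity
  refine ⟨3 ^ (d : ℝ) * I, by positivity, fun s hs => ?_⟩
  have hm : Measurable (hypP e) := (hypP e).continuous.measurable
  have hF : Measurable fun x : W => ENNReal.ofReal ((s ^ 2 + ‖x‖ ^ 2) ^ (-((d : ℝ) + 2) / 2)) := by
    fun_prop
  have heq : (fun x : W => (s ^ 2 + ‖x‖ ^ 2) ^ (-((d : ℝ) + 2) / 2)) =
      fun x : W => s ^ (-((d : ℝ) + 2)) * (((1 : ℝ) + ‖s⁻¹ • x‖ ^ 2) ^ (-((d : ℝ) + 2) / 2)) := by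
    funext x
    have : s ^ 2 + ‖x‖ ^ 2 = s ^ 2 * (1 + ‖s⁻¹ • x‖ ^ 2) := by
      rw [norm_smul, norm_inv, Real.norm_of_nonneg hs.le]; field_simp
    rw [this, Real.mul_rpow (by positivity) (by positivity), ← Real.rpow_natCast,
      ← Real.rpow_mul hs.le]
    congr 2; push_cast; ring
  have hintg2 : Integrable (fun x : W => (s ^ 2 + ‖x‖ ^ 2) ^ (-((d : ℝ) + 2) / 2)) μH[(d : ℝ)] := by
    rw [heq]
    exact (hintg.comp_smul (inv_ne_zero hs.ne')).const_mul _
  have hval : ∫ x : W, (s ^ 2 + ‖x‖ ^ 2) ^ (-((d : ℝ) + 2) / 2) ∂μH[(d : ℝ)] = I / s ^ 2 := by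
    rw [heq, integral_const_mul, Measure.integral_comp_inv_smul μH[(d : ℝ)]
      (fun x : W => ((1 : ℝ) + ‖x‖ ^ 2) ^ (-((d : ℝ) + 2) / 2)), hfr, ← hI,
      abs_of_nonneg (by positivity), smul_eq_mul, Real.rpow_neg hs.le, Real.rpow_add hs,
      Real.rpow_natCast]
    have : s ^ (2 : ℝ) = s ^ 2 := by norm_cast
    rw [this]
    field_simp
  calc ∫⁻ y in cap e, ENNReal.ofReal ((s ^ 2 + ‖e - y‖ ^ 2) ^ (-((d : ℝ) + 2) / 2)) ∂μH[(d : ℝ)]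
      ≤ ∫⁻ y in cap e, ENNReal.ofReal ((s ^ 2 + ‖hypP e y‖ ^ 2) ^ (-((d : ℝ) + 2) / 2))
          ∂μH[(d : ℝ)] := by
        refine lintegral_mono fun y => ?_
        apply ENNReal.ofReal_le_ofReal
        apply Real.rpow_le_rpow_of_nonpos (by positivity) _ (by
          have : (0 : ℝ) ≤ d := by positivity
          linarith)
        have := hypP_norm_le e (e - y)
        rw [map_sub, hypP_self e he, zero_sub, norm_neg] at this
        gcongr
    _ = ∫⁻ x, ENNReal.ofReal ((s ^ 2 + ‖x‖ ^ 2) ^ (-((d : ℝ) + 2) / 2))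
          ∂(((μH[(d : ℝ)] : Measure E).restrict (cap e)).map (hypP e)) := by
        rw [lintegral_map hF hm]
    _ ≤ ∫⁻ x, ENNReal.ofReal ((s ^ 2 + ‖x‖ ^ 2) ^ (-((d : ℝ) + 2) / 2))
          ∂(((3 : ℝ≥0∞) ^ (d : ℝ)) • (μH[(d : ℝ)] : Measure W)) :=
        lintegral_mono' (cap_map_le e he d (by positivity)) le_rfl
    _ = ENNReal.ofReal (3 ^ (d : ℝ) * I / s ^ 2) := by
        rw [lintegral_smul_measure, ← ofReal_integral_eq_lintegral_ofReal hintg2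
          (Filter.Eventually.of_forall fun x => by positivity), hval, smul_eq_mul, mul_div_assoc,
          ENNReal.ofReal_mul (by positivity), ← ENNReal.ofReal_rpow_of_pos (by norm_num)]
        simp

/-- lower bound on the measure of small caps -/
lemma cap_lower [MeasurableSpace E] [BorelSpace E] (e : E) (he : ‖e‖ = 1) (d : ℕ)
    (hd : finrank ℝ E = d + 1) :
    ∃ c : ℝ, 0 < c ∧ ∀ t : ℝ, 0 < t → t ≤ 1 →
      ENNReal.ofReal (c * t ^ d) ≤ μH[(d : ℝ)] (Metric.sphere (0 : E) 1 ∩ {y | ‖e - y‖ ≤ t}) := by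
  have hfr := hyp_finrank e he d hd
  set W := (Submodule.span ℝ {e})ᗮ with hW
  have hH : Measure.IsAddHaarMeasure (μH[(d : ℝ)] : Measure W) := by
    have := @isAddHaarMeasure_hausdorffMeasure W _ _ _ _ _
    rwa [hfr] at this
  set μ : Measure W := μH[(d : ℝ)]
  have hb0 : 0 < μ (Metric.closedBall 0 1) := by
    apply Metric.measure_closedBall_pos; norm_num
  have hb1 : μ (Metric.closedBall 0 1) < ⊤ := measure_closedBall_lt_top
  have hc : 0 < (μ (Metric.closedBall 0 1)).toReal := ENNReal.toReal_pos hb0.ne' hb1.ne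
  refine ⟨(μ (Metric.closedBall 0 1)).toReal / 2 ^ d, by positivity, fun t ht ht1 => ?_⟩
  have h1 : μ (Metric.closedBall 0 (t / 2)) =
      ENNReal.ofReal ((μ (Metric.closedBall 0 1)).toReal / 2 ^ d * t ^ d) := by
    rw [Measure.addHaar_closedBall' μ 0 (by positivity : 0 ≤ t / 2), hfr,
      show (μ (Metric.closedBall 0 1)).toReal / 2 ^ d * t ^ d =
        (t / 2) ^ d * (μ (Metric.closedBall 0 1)).toReal by rw [div_pow]; ring,
      ENNReal.ofReal_mul (by positivity), ENNReal.ofReal_toReal hb1.ne]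
  rw [← h1]
  refine le_trans (measure_mono ?_)
    (hausdorffMeasure_orthogonalProjectionOnto_le (𝕜 := ℝ) (Submodule.span ℝ {e})ᗮ (d : ℝ) _ (by positivity))
  intro z hz
  rw [mem_closedBall_zero_iff] at hz
  have hz2 : ‖z‖ ^ 2 ≤ (t / 2) ^ 2 := by gcongr
  have horth : inner ℝ e (z : E) = 0 := by
    exact Submodule.mem_orthogonal_singleton_iff_inner_right.1 z.2
  have hz1 : 0 ≤ 1 - ‖z‖ ^ 2 := by nlinarith
  set h := Real.sqrt (1 - ‖z‖ ^ 2)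
  have hh : h ^ 2 = 1 - ‖z‖ ^ 2 := Real.sq_sqrt hz1
  have hh0 : 0 ≤ h := Real.sqrt_nonneg _
  have hh1 : h ≤ 1 := by nlinarith [sq_nonneg ‖z‖]
  have hzn : ‖(z : E)‖ = ‖z‖ := rfl
  refine ⟨(z : E) + h • e, ⟨?_, ?_⟩, ?_⟩
  · rw [mem_sphere_zero_iff_norm]
    have : ‖(z : E) + h • e‖ ^ 2 = 1 := by
      rw [@norm_add_sq_real, inner_smul_right, real_inner_comm, horth, norm_smul, he, hzn,
        Real.norm_of_nonneg hh0]
      linarith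
    nlinarith [norm_nonneg ((z : E) + h • e)]
  · show ‖e - ((z : E) + h • e)‖ ≤ t
    apply le_of_sq_le_sq _ ht.le
    have : e - ((z : E) + h • e) = (1 - h) • e - (z : E) := by module
    rw [this, @norm_sub_sq_real, inner_smul_left, horth, norm_smul, he, hzn,
      Real.norm_of_nonneg (by linarith : 0 ≤ 1 - h)]
    nlinarith
  · change hypP e _ = z
    apply Subtype.ext
    rw [hypP_coe e he, inner_add_right, horth, inner_smul_right, real_inner_self_eq_norm_sq, he]
    simp
end Geo

section Ana

lemma rpow_diff_upper {X Y q : ℝ} (hX : 0 < X) (hXY : X ≤ Y) (hq : 0 ≤ q) :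
    X ^ (-q) - Y ^ (-q) ≤ q * (Y - X) * X ^ (-q - 1) := by
  have hY : 0 < Y := hX.trans_le hXY
  have hz : 0 < Y / X := by positivity
  have h1 : 1 - q * (Y / X - 1) ≤ (Y / X) ^ (-q) := by
    rw [Real.rpow_def_of_pos hz]
    have := Real.add_one_le_exp (Real.log (Y / X) * -q)
    have h2 := Real.log_le_sub_one_of_pos hz
    nlinarith
  have h3 : Y ^ (-q) = X ^ (-q) * (Y / X) ^ (-q) := by
    rw [← Real.mul_rpow hX.le hz.le]; congr 1; field_simp
  have h4 : X ^ (-q - 1) = X ^ (-q) / X := by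
    rw [Real.rpow_sub hX, Real.rpow_one]
  have hp : 0 < X ^ (-q) := by positivity
  rw [h3, h4]
  have : q * (Y - X) * (X ^ (-q) / X) = X ^ (-q) * (q * (Y / X - 1)) := by field_simp
  rw [this]
  nlinarith

lemma kern_diff_upper {s t u : ℝ} (d : ℕ) (hs : 0 < s) (hst : s ≤ t) :
    |(s ^ 2 + u ^ 2) ^ (-(d : ℝ) / 2) - (t ^ 2 + u ^ 2) ^ (-(d : ℝ) / 2)| ≤
      d * ((t - s) * t) * (s ^ 2 + u ^ 2) ^ (-((d : ℝ) + 2) / 2) := by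
  have hXY : s ^ 2 + u ^ 2 ≤ t ^ 2 + u ^ 2 := by gcongr
  have hX : 0 < s ^ 2 + u ^ 2 := by positivity
  have hd : (0 : ℝ) ≤ d := by positivity
  rw [abs_of_nonneg]
  · have := rpow_diff_upper hX hXY (q := (d : ℝ) / 2) (by positivity)
    rw [neg_div]
    refine this.trans ?_
    rw [show -((d : ℝ) / 2) - 1 = -((d : ℝ) + 2) / 2 by ring]
    gcongr ?_ * _
    nlinarith [mul_nonneg hd (sq_nonneg (t - s))]
  · rw [sub_nonneg]
    exact Real.rpow_le_rpow_of_nonpos hX hXY (by linarith)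

lemma kern_diff_lower {a t u : ℝ} (d : ℕ) (hd : 1 ≤ d) (ha : 1 < a) (ht : 0 < t) (hu0 : 0 ≤ u)
    (hu : u ≤ t) :
    (1 - ((a ^ 2 + 1) / 2) ^ (-(d : ℝ) / 2)) * 2 ^ (-(d : ℝ) / 2) / t ^ d ≤
    (t ^ 2 + u ^ 2) ^ (-(d : ℝ) / 2) - ((a * t) ^ 2 + u ^ 2) ^ (-(d : ℝ) / 2)  := by
  have hd' : (1 : ℝ) ≤ d := by exact_mod_cast hd
  have hq : -(d : ℝ) / 2 ≤ 0 := by linarith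
  have hX : 0 < t ^ 2 + u ^ 2 := by positivity
  have hu2 : u ^ 2 ≤ t ^ 2 := by gcongr
  have h1 : ((a * t) ^ 2 + u ^ 2) ^ (-(d : ℝ) / 2) ≤
      ((a ^ 2 + 1) / 2) ^ (-(d : ℝ) / 2) * (t ^ 2 + u ^ 2) ^ (-(d : ℝ) / 2) := by
    rw [← Real.mul_rpow (by positivity) hX.le]
    apply Real.rpow_le_rpow_of_nonpos (by positivity) _ hq
    have ha2 : 0 ≤ a ^ 2 - 1 := by nlinarith
    nlinarith [mul_nonneg ha2 (sub_nonneg.2 hu2)]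
  have h2 : 2 ^ (-(d : ℝ) / 2) / t ^ d ≤ (t ^ 2 + u ^ 2) ^ (-(d : ℝ) / 2) := by
    have : (2 : ℝ) ^ (-(d : ℝ) / 2) / t ^ d = (2 * t ^ 2) ^ (-(d : ℝ) / 2) := by
      rw [Real.mul_rpow (by positivity) (by positivity), ← Real.rpow_natCast t 2,
        ← Real.rpow_mul ht.le, div_eq_mul_inv, ← Real.rpow_natCast, ← Real.rpow_neg ht.le]
      congr 2; push_cast; ring
    rw [this]
    apply Real.rpow_le_rpow_of_nonpos hX (by linarith) hq
  have h3 : ((a ^ 2 + 1) / 2) ^ (-(d : ℝ) / 2) ≤ 1 := by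
    apply Real.rpow_le_one_of_one_le_of_nonpos (by nlinarith) hq
  rw [mul_div_assoc]
  nlinarith

lemma eFun1_neg (n : ℕ) (e₁ : EuclideanSpace ℝ (Fin (n - 1))) (t : ℝ) :
    eFun1 n e₁ (-t) = eFun1 n e₁ t := by
  simp [eFun1]

lemma eFun1_abs (n : ℕ) (e₁ : EuclideanSpace ℝ (Fin (n - 1))) (t : ℝ) :
    eFun1 n e₁ |t| = eFun1 n e₁ t := by
  simp [eFun1]

lemma kern_integrable {E : Type*} [NormedAddCommGroup E] [InnerProductSpace ℝ E]
    [FiniteDimensional ℝ E] [MeasurableSpace E] [BorelSpace E] (e : E) (d : ℕ)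
    (μ : Measure E) [IsFiniteMeasure μ] (t : ℝ) (ht : 0 < t) :
    Integrable (fun y => (t ^ 2 + ‖e - y‖ ^ 2) ^ (-(d : ℝ) / 2)) μ := by
  refine Integrable.of_bound ?_ ((t ^ 2) ^ (-(d : ℝ) / 2)) ?_
  · apply Measurable.aestronglyMeasurable
    fun_prop
  · refine Filter.Eventually.of_forall fun y => ?_
    rw [Real.norm_of_nonneg (by positivity)]
    apply Real.rpow_le_rpow_of_nonpos (by positivity)
    · nlinarith [sq_nonneg ‖e - y‖]
    · have : (0 : ℝ) ≤ d := by positivity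
      linarith

open Module in
lemma kern_int_upper {E : Type*} [NormedAddCommGroup E] [InnerProductSpace ℝ E]
    [FiniteDimensional ℝ E] [MeasurableSpace E] [BorelSpace E] (e : E) (he : ‖e‖ = 1) (d : ℕ)
    (hd : finrank ℝ E = d + 1)
    (hfin : (μH[(d : ℝ)] : Measure E) (Metric.sphere 0 1) ≠ ⊤) :
    ∃ C : ℝ, 0 ≤ C ∧ ∀ s t : ℝ, 0 < s → s ≤ t →
      |(∫ y in Metric.sphere (0 : E) 1, (s ^ 2 + ‖e - y‖ ^ 2) ^ (-(d : ℝ) / 2) ∂μH[(d : ℝ)]) -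
        ∫ y in Metric.sphere (0 : E) 1, (t ^ 2 + ‖e - y‖ ^ 2) ^ (-(d : ℝ) / 2) ∂μH[(d : ℝ)]|
        ≤ C * ((t - s) * t / s ^ 2) := by
  obtain ⟨C, hC0, hC⟩ := cap_lintegral e he d hd
  set μ : Measure E := μH[(d : ℝ)].restrict (Metric.sphere 0 1) with hμ
  have : IsFiniteMeasure μ := ⟨by rw [hμ, Measure.restrict_apply_univ]; exact hfin.lt_top⟩
  set T := (μH[(d : ℝ)] (Metric.sphere (0 : E) 1)).toReal
  have hT : 0 ≤ T := ENNReal.toReal_nonneg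
  refine ⟨d * (C + T), by positivity, fun s t hs hst => ?_⟩
  have ht : 0 < t := hs.trans_le hst
  have hmain : ∫⁻ y, ENNReal.ofReal ((s ^ 2 + ‖e - y‖ ^ 2) ^ (-((d : ℝ) + 2) / 2)) ∂μ ≤
      ENNReal.ofReal ((C + T) / s ^ 2) := by
    have hsub : Metric.sphere (0 : E) 1 ⊆ cap e ∪ (Metric.sphere (0 : E) 1 \ cap e) := by
      intro y hy
      by_cases h : y ∈ cap e
      · exact Or.inl h
      · exact Or.inr ⟨hy, h⟩
    have hcm : MeasurableSet (cap e) := by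
      have h1 : IsClosed {y : E | ‖y‖ = 1} := isClosed_eq continuous_norm continuous_const
      have h2 : IsClosed {y : E | 1 / 2 ≤ inner ℝ e y} :=
        isClosed_le continuous_const (by fun_prop)
      exact (h1.inter h2).measurableSet
    have hfm : MeasurableSet (Metric.sphere (0 : E) 1 \ cap e) :=
      Metric.isClosed_sphere.measurableSet.diff hcm
    calc _ ≤ _ := lintegral_mono_set hsub
      _ ≤ _ := lintegral_union_le _ _ _
      _ ≤ ENNReal.ofReal (C / s ^ 2) + ENNReal.ofReal (T / s ^ 2) := by
        gcongr
        · exact hC s hs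
        · calc _ ≤ ∫⁻ y in Metric.sphere (0 : E) 1 \ cap e, ENNReal.ofReal (1 / s ^ 2)
                ∂μH[(d : ℝ)] := by
                apply setLIntegral_mono measurable_const
                intro y hy
                apply ENNReal.ofReal_le_ofReal
                have hy1 : ‖y‖ = 1 := by simpa using hy.1
                have hy2 : inner ℝ e y < 1 / 2 := by
                  by_contra hcon
                  exact hy.2 ⟨hy1, not_lt.1 hcon⟩
                have hu : 1 ≤ ‖e - y‖ ^ 2 := by
                  rw [@norm_sub_sq_real, he, hy1]; linarith
                have hdn : (0 : ℝ) ≤ d := by positivity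
                rw [show -((d : ℝ) + 2) / 2 = -(d : ℝ) / 2 + -1 by ring,
                  Real.rpow_add (by positivity), Real.rpow_neg_one, one_div]
                have h1 : (s ^ 2 + ‖e - y‖ ^ 2) ^ (-(d : ℝ) / 2) ≤ 1 :=
                  Real.rpow_le_one_of_one_le_of_nonpos (by nlinarith [sq_nonneg s]) (by linarith)
                have h2 : (s ^ 2 + ‖e - y‖ ^ 2)⁻¹ ≤ (s ^ 2)⁻¹ := by
                  gcongr; linarith
                calc _ ≤ 1 * (s ^ 2)⁻¹ := by gcongr
                  _ = _ := one_mul _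
            _ = ENNReal.ofReal (1 / s ^ 2) * μH[(d : ℝ)] (Metric.sphere (0 : E) 1 \ cap e) := by
                rw [setLIntegral_const]
            _ ≤ ENNReal.ofReal (1 / s ^ 2) * μH[(d : ℝ)] (Metric.sphere (0 : E) 1) := by
                gcongr; exact Set.sdiff_subset
            _ = ENNReal.ofReal (T / s ^ 2) := by
                rw [← ENNReal.ofReal_toReal hfin, ← ENNReal.ofReal_mul (by positivity)]
                congr 1
                change 1 / s ^ 2 * T = _
                ring
      _ = _ := by
        rw [← ENNReal.ofReal_add (by positivity) (by positivity)]; congr 1; ring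
  have hintg : Integrable (fun y => (s ^ 2 + ‖e - y‖ ^ 2) ^ (-((d : ℝ) + 2) / 2)) μ := by
    have := kern_integrable e (d + 2) μ s hs
    push_cast at this
    exact this
  have hreal : ∫ y, (s ^ 2 + ‖e - y‖ ^ 2) ^ (-((d : ℝ) + 2) / 2) ∂μ ≤ (C + T) / s ^ 2 := by
    rw [← ofReal_integral_eq_lintegral_ofReal hintg
          (Filter.Eventually.of_forall fun x => by positivity)] at hmain
    exact (ENNReal.ofReal_le_ofReal_iff (by positivity)).1 hmain
  rw [← integral_sub (kern_integrable e d μ s hs) (kern_integrable e d μ t ht)]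
  calc _ ≤ ∫ y, |(s ^ 2 + ‖e - y‖ ^ 2) ^ (-(d : ℝ) / 2) - (t ^ 2 + ‖e - y‖ ^ 2) ^ (-(d : ℝ) / 2)| ∂μ :=
        abs_integral_le_integral_abs
    _ ≤ ∫ y, d * ((t - s) * t) * (s ^ 2 + ‖e - y‖ ^ 2) ^ (-((d : ℝ) + 2) / 2) ∂μ := by
        apply integral_mono_of_nonneg
        · exact Filter.Eventually.of_forall fun y => abs_nonneg _
        · exact hintg.const_mul _
        · exact Filter.Eventually.of_forall fun y => kern_diff_upper d hs hst
    _ = d * ((t - s) * t) * ∫ y, (s ^ 2 + ‖e - y‖ ^ 2) ^ (-((d : ℝ) + 2) / 2) ∂μ :=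
        integral_const_mul _ _
    _ ≤ d * ((t - s) * t) * ((C + T) / s ^ 2) := by
        have : 0 ≤ t - s := by linarith
        gcongr
    _ = _ := by ring

open Module in
lemma kern_int_lower {E : Type*} [NormedAddCommGroup E] [InnerProductSpace ℝ E]
    [FiniteDimensional ℝ E] [MeasurableSpace E] [BorelSpace E] (e : E) (he : ‖e‖ = 1) (d : ℕ)
    (hd1 : 1 ≤ d) (hd : finrank ℝ E = d + 1)
    (hfin : (μH[(d : ℝ)] : Measure E) (Metric.sphere 0 1) ≠ ⊤) (a : ℝ) (ha : 1 < a) :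
    ∃ D : ℝ, 0 < D ∧ ∀ t : ℝ, 0 < t → t ≤ 1 → D ≤
      (∫ y in Metric.sphere (0 : E) 1, (t ^ 2 + ‖e - y‖ ^ 2) ^ (-(d : ℝ) / 2) ∂μH[(d : ℝ)]) -
        ∫ y in Metric.sphere (0 : E) 1, ((a * t) ^ 2 + ‖e - y‖ ^ 2) ^ (-(d : ℝ) / 2) ∂μH[(d : ℝ)]
         := by
  obtain ⟨c, hc0, hc⟩ := cap_lower e he d hd
  set μ : Measure E := μH[(d : ℝ)].restrict (Metric.sphere 0 1) with hμ
  have : IsFiniteMeasure μ := ⟨by rw [hμ, Measure.restrict_apply_univ]; exact hfin.lt_top⟩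
  have hd' : (1 : ℝ) ≤ d := by exact_mod_cast hd1
  set q := (1 - ((a ^ 2 + 1) / 2) ^ (-(d : ℝ) / 2)) * 2 ^ (-(d : ℝ) / 2) with hqd
  have hq : 0 < q := by
    apply mul_pos _ (by positivity)
    rw [sub_pos]
    apply Real.rpow_lt_one_of_one_lt_of_neg (by nlinarith) (by linarith)
  refine ⟨q * c, by positivity, fun t ht ht1 => ?_⟩
  have hat : 0 < a * t := by positivity
  have hi := (kern_integrable e d μ t ht).sub (kern_integrable e d μ (a * t) hat)
  rw [← integral_sub (kern_integrable e d μ t ht) (kern_integrable e d μ (a * t) hat)]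
  have hnn : ∀ y, 0 ≤ (t ^ 2 + ‖e - y‖ ^ 2) ^ (-(d : ℝ) / 2) -
      ((a * t) ^ 2 + ‖e - y‖ ^ 2) ^ (-(d : ℝ) / 2) := fun y => by
    rw [sub_nonneg]
    apply Real.rpow_le_rpow_of_nonpos (by positivity) _ (by linarith)
    have : t ≤ a * t := by nlinarith
    gcongr
  have hBm : MeasurableSet {y : E | ‖e - y‖ ≤ t} :=
    (isClosed_le (by fun_prop) continuous_const).measurableSet
  have hμB : c * t ^ d ≤ (μ {y : E | ‖e - y‖ ≤ t}).toReal := by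
    rw [← ENNReal.ofReal_le_iff_le_toReal (measure_ne_top _ _), hμ, Measure.restrict_apply hBm,
      Set.inter_comm]
    exact hc t ht ht1
  calc q * c = q / t ^ d * (c * t ^ d) := by field_simp
    _ ≤ q / t ^ d * (μ {y : E | ‖e - y‖ ≤ t}).toReal := by gcongr
    _ = ∫ y in {y : E | ‖e - y‖ ≤ t}, q / t ^ d ∂μ := by
        rw [setIntegral_const, smul_eq_mul, mul_comm]; rfl
    _ ≤ ∫ y in {y : E | ‖e - y‖ ≤ t}, ((t ^ 2 + ‖e - y‖ ^ 2) ^ (-(d : ℝ) / 2) -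
      ((a * t) ^ 2 + ‖e - y‖ ^ 2) ^ (-(d : ℝ) / 2)) ∂μ := by
        apply setIntegral_mono_on
        · exact integrableOn_const (measure_ne_top _ _)
        · exact hi.integrableOn
        · exact hBm
        · intro y hy
          exact kern_diff_lower d hd1 ha ht (norm_nonneg _) hy
    _ ≤ _ := setIntegral_le_integral hi (Filter.Eventually.of_forall hnn)

lemma eFun1_bounds (n : ℕ) (hn : 3 ≤ n)
    (e₁ : EuclideanSpace ℝ (Fin (n - 1))) (he₁ : ‖e₁‖ = 1) (hC : sphC n ≠ 0) (a : ℝ) (ha : 1 < a) :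
    (∃ C : ℝ, 0 ≤ C ∧ ∀ s t : ℝ, 0 < s → s ≤ t →
      |eFun1 n e₁ s - eFun1 n e₁ t| ≤ C * ((t - s) * t / s ^ 2)) ∧
    (∃ D : ℝ, 0 < D ∧ ∀ t : ℝ, 0 < t → t ≤ 1 → D ≤ eFun1 n e₁ t - eFun1 n e₁ (a * t)) := by
  obtain ⟨d, rfl⟩ : ∃ d, n = d + 2 := ⟨n - 2, by omega⟩
  have hexp : ((d + 2 : ℕ) : ℝ) - 2 = d := by push_cast; ring
  have hexp2 : (2 - ((d + 2 : ℕ) : ℝ)) / 2 = -(d : ℝ) / 2 := by push_cast; ring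
  have hfin : (μH[(d : ℝ)] : Measure (EuclideanSpace ℝ (Fin (d + 2 - 1)))) (Metric.sphere 0 1) ≠ ⊤ := by
    intro h
    apply hC
    rw [sphC, hexp, h]; rfl
  have hpos : 0 < sphC (d + 2) := lt_of_le_of_ne ENNReal.toReal_nonneg hC.symm
  have hfr : Module.finrank ℝ (EuclideanSpace ℝ (Fin (d + 2 - 1))) = d + 1 := by simp
  constructor
  · obtain ⟨C, hC0, hC⟩ := kern_int_upper e₁ he₁ d hfr hfin
    refine ⟨(sphC (d + 2))⁻¹ * C, by positivity, fun s t hs hst => ?_⟩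
    simp only [eFun1, hexp, hexp2]
    rw [← mul_sub, abs_mul, abs_of_pos (inv_pos.2 hpos), mul_assoc]
    gcongr
    exact hC s t hs hst
  · obtain ⟨D, hD0, hD⟩ := kern_int_lower e₁ he₁ d (by omega) hfr hfin a ha
    refine ⟨(sphC (d + 2))⁻¹ * D, by positivity, fun t ht ht1 => ?_⟩
    simp only [eFun1, hexp, hexp2]
    rw [← mul_sub]
    gcongr
    exact hD t ht ht1
end Ana

section Comb

lemma sgn_abs (b : Bool) : |sgn b| = 1 := by cases b <;> simp [sgn]

lemma fN_succ (r : ℝ) (A : ℕ → (ℕ → Bool) → ℝ) (m : ℕ) (ε : ℕ → Bool) :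
    fN r A (m + 1) ε = fN r A m ε + A m ε / 2 * r ^ m * sgn (ε m) := by
  simp [fN, Finset.sum_range_succ]

lemma fN_congr (r : ℝ) (A B : ℕ → (ℕ → Bool) → ℝ) (M : ℕ) (ε ε' : ℕ → Bool)
    (h : ∀ k < M, A k ε = B k ε') (h' : ∀ k < M, ε k = ε' k) : fN r A M ε = fN r B M ε' := by
  apply Finset.sum_congr rfl
  intro k hk
  rw [h k (Finset.mem_range.1 hk), h' k (Finset.mem_range.1 hk)]

lemma fN_sep (r : ℝ) (hr : 0 < r) (hr16 : r ≤ 1 / 16) (A : ℕ → (ℕ → Bool) → ℝ) (M : ℕ)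
    (hA : ∀ k < M, ∀ ε, 1 ≤ A k ε ∧ A k ε ≤ 3)
    (hdep : ∀ k < M, ∀ ε ε', (∀ j < k, ε j = ε' j) → A k ε = A k ε')
    (ε ε' : ℕ → Bool) (j : ℕ) (hj : j < M) (hlt : ∀ i < j, ε i = ε' i) (hne : ε j ≠ ε' j) :
    4 / 5 * r ^ j ≤ |fN r A M ε - fN r A M ε'| := by
  have key : ∀ N, j + 1 ≤ N → N ≤ M →
      4 / 5 * r ^ j + 16 / 5 * r ^ N ≤ |fN r A N ε - fN r A N ε'| := by
    intro N hN
    induction N, hN using Nat.le_induction with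
    | base =>
      intro _
      rw [fN_succ, fN_succ, hdep j hj ε ε' hlt, fN_congr r A A j ε ε'
        (fun k hk => hdep k (hk.trans hj) _ _ fun i hi => hlt i (hi.trans hk)) hlt]
      have h1 := (hA j hj ε').1
      have h2 : |fN r A j ε' + A j ε' / 2 * r ^ j * sgn (ε j) -
          (fN r A j ε' + A j ε' / 2 * r ^ j * sgn (ε' j))| = A j ε' * r ^ j := by
        have hp : 0 < A j ε' * r ^ j := by positivity
        rcases hb : ε j <;> rcases hb' : ε' j
        · exact absurd (hb.trans hb'.symm) hne
        · simp only [sgn]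
          rw [abs_of_neg (by simp; linarith)]; simp; ring
        · simp only [sgn]
          rw [abs_of_pos (by simp; linarith)]; simp; ring
        · exact absurd (hb.trans hb'.symm) hne
      rw [h2, pow_succ]
      have : 0 < r ^ j := by positivity
      nlinarith
    | succ N hN ih =>
      intro hNM
      have ih := ih (by omega)
      rw [fN_succ, fN_succ]
      have hb : ∀ ε, |A N ε / 2 * r ^ N * sgn (ε N)| ≤ 3 / 2 * r ^ N := by
        intro ε
        have := hA N (by omega) ε
        rw [abs_mul, sgn_abs, mul_one, abs_of_nonneg (by
          have : 0 ≤ A N ε := by linarith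
          positivity)]
        gcongr
        linarith
      have h1 := hb ε
      have h2 := hb ε'
      have hp : 0 < r ^ N := by positivity
      have h3 : r ^ (N + 1) ≤ r ^ N / 16 := by rw [pow_succ]; nlinarith
      have h4 : |fN r A N ε - fN r A N ε'| ≤
          |fN r A N ε + A N ε / 2 * r ^ N * sgn (ε N) -
            (fN r A N ε' + A N ε' / 2 * r ^ N * sgn (ε' N))| +
          (|A N ε / 2 * r ^ N * sgn (ε N)| + |A N ε' / 2 * r ^ N * sgn (ε' N)|) := by
        generalize A N ε / 2 * r ^ N * sgn (ε N) = p
        generalize A N ε' / 2 * r ^ N * sgn (ε' N) = q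
        rw [show fN r A N ε - fN r A N ε' = (fN r A N ε + p - (fN r A N ε' + q)) + (q - p) by ring]
        refine (abs_add_le _ _).trans ?_
        gcongr
        rw [add_comm]
        exact abs_sub _ _
      linarith
  have := key M hj le_rfl
  have hp : 0 < r ^ M := by positivity
  linarith

lemma count_agree (M j : ℕ) (hj : j ≤ M) (τ : Fin M → Bool) :
    (Finset.univ.filter fun τ' : Fin M → Bool => ∀ i : Fin M, i.1 < j → τ i = τ' i).card
      ≤ 2 ^ (M - j) := by
  have : (2 : ℕ) ^ (M - j) = (Finset.univ : Finset (Fin (M - j) → Bool)).card := by simp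
  rw [this]
  apply Finset.card_le_card_of_injOn (fun τ' i => τ' ⟨j + i.1, by omega⟩) (fun _ _ => by simp)
  intro σ hσ ρ hρ h
  simp only [Finset.coe_filter, Finset.mem_univ, true_and, Set.mem_ofPred_eq] at hσ hρ
  funext i
  by_cases hi : i.1 < j
  · rw [← hσ i hi, hρ i hi]
  · have := congrFun h ⟨i.1 - j, by omega⟩
    simp only at this
    have hh : (⟨j + (i.1 - j), by omega⟩ : Fin M) = i := by ext; simp; omega
    rwa [hh] at this

/-- Summation of errors over all words different from `τ`. -/
lemma sum_err (r : ℝ) (hr : 0 < r) (hr16 : r ≤ 1 / 16) (M : ℕ) (τ : Fin M → Bool)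
    (B : ℝ) (hB : 0 ≤ B) (w : (Fin M → Bool) → ℝ)
    (hw : ∀ τ' : Fin M → Bool, ∀ j : Fin M, (∀ i : Fin M, i.1 < j.1 → τ i = τ' i) → τ j ≠ τ' j →
      w τ' ≤ B * r ^ (M - j.1)) :
    ∑ τ' ∈ Finset.univ.erase τ, w τ' ≤ B * (4 * r) := by
  have h1 : ∀ τ' ∈ Finset.univ.erase τ, w τ' ≤ ∑ j : Fin M,
      if (∀ i : Fin M, i.1 < j.1 → τ i = τ' i) then B * r ^ (M - j.1) else 0 := by
    intro τ' hτ'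
    have hne : τ' ≠ τ := (Finset.mem_erase.1 hτ').1
    have hex : ∃ k : ℕ, ∃ h : k < M, τ ⟨k, h⟩ ≠ τ' ⟨k, h⟩ := by
      by_contra hcon
      push Not at hcon
      exact hne (funext fun i => (hcon i.1 i.2).symm)
    classical
    obtain ⟨hjM, hj⟩ := Nat.find_spec hex
    set j : Fin M := ⟨Nat.find hex, hjM⟩
    have hlt : ∀ i : Fin M, i.1 < j.1 → τ i = τ' i := by
      intro i hi
      by_contra hcon
      exact Nat.find_min hex hi ⟨i.2, hcon⟩
    refine (hw τ' j hlt hj).trans ?_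
    have := Finset.single_le_sum (f := fun j : Fin M => if (∀ i : Fin M, i.1 < j.1 → τ i = τ' i)
      then B * r ^ (M - j.1) else 0) (s := Finset.univ) (fun i _ => by
        split_ifs <;> positivity) (Finset.mem_univ j)
    rwa [if_pos hlt] at this
  calc _ ≤ ∑ τ' ∈ Finset.univ.erase τ, ∑ j : Fin M,
      (if (∀ i : Fin M, i.1 < j.1 → τ i = τ' i) then B * r ^ (M - j.1) else 0) :=
        Finset.sum_le_sum h1
    _ ≤ ∑ τ' : Fin M → Bool, ∑ j : Fin M,
      (if (∀ i : Fin M, i.1 < j.1 → τ i = τ' i) then B * r ^ (M - j.1) else 0) := by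
        apply Finset.sum_le_sum_of_subset_of_nonneg (Finset.subset_univ _)
        intro i _ _
        apply Finset.sum_nonneg
        intro j _
        split_ifs <;> positivity
    _ = ∑ j : Fin M, ∑ τ' : Fin M → Bool,
      (if (∀ i : Fin M, i.1 < j.1 → τ i = τ' i) then B * r ^ (M - j.1) else 0) :=
        Finset.sum_comm
    _ ≤ ∑ j : Fin M, B * (2 * r) ^ (M - j.1) := by
        apply Finset.sum_le_sum
        intro j _
        rw [← Finset.sum_filter, Finset.sum_const, nsmul_eq_mul, mul_pow]
        have := count_agree M j.1 j.2.le τ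
        have h2 : ((Finset.univ.filter fun τ' : Fin M → Bool =>
          ∀ i : Fin M, i.1 < j.1 → τ i = τ' i).card : ℝ) ≤ 2 ^ (M - j.1) := by exact_mod_cast this
        calc _ ≤ 2 ^ (M - j.1) * (B * r ^ (M - j.1)) := by gcongr
          _ = _ := by ring
    _ = B * ∑ j ∈ Finset.range M, (2 * r) ^ (M - j) := by
        rw [Finset.mul_sum, Finset.sum_range]
    _ ≤ B * (4 * r) := by
        gcongr
        have : ∀ N : ℕ, ∑ j ∈ Finset.range N, (2 * r) ^ (N - j) ≤ 4 * r := by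
          intro N
          induction N with
          | zero => simp; positivity
          | succ N ih =>
            rw [Finset.sum_range_succ]
            have : ∑ j ∈ Finset.range N, (2 * r) ^ (N + 1 - j) =
                (2 * r) * ∑ j ∈ Finset.range N, (2 * r) ^ (N - j) := by
              rw [Finset.mul_sum]
              apply Finset.sum_congr rfl
              intro j hj
              have := Finset.mem_range.1 hj
              rw [show N + 1 - j = (N - j) + 1 by omega, pow_succ]; ring
            rw [this]
            simp only [Nat.add_sub_cancel_left, pow_one]
            nlinarith
        exact this M

lemma e_perturb (e : ℝ → ℝ) (heven : ∀ t, e |t| = e t) (C : ℝ) (hC0 : 0 ≤ C)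
    (hC : ∀ s t : ℝ, 0 < s → s ≤ t → |e s - e t| ≤ C * ((t - s) * t / s ^ 2))
    (u v ρ : ℝ) (hρ : 0 < ρ) (hu : 4 / 5 * ρ ≤ |u|) (huv : |u - v| ≤ 3 / 16 * ρ) :
    |e u - e v| ≤ 4 * C * (|u - v| / ρ) := by
  have h1 : |(|u| - |v|)| ≤ |u - v| := abs_abs_sub_abs_le_abs_sub u v
  have key : ∀ s t : ℝ, 3 / 5 * ρ ≤ s → s ≤ t → t - s ≤ |u - v| →
      |e s - e t| ≤ 4 * C * (|u - v| / ρ) := by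
    intro s t hs hst hts
    have hs0 : 0 < s := by linarith
    refine (hC s t hs0 hst).trans ?_
    have : (t - s) * t / s ^ 2 ≤ 4 * (|u - v| / ρ) := by
      rw [← mul_div_assoc, div_le_div_iff₀ (by positivity) hρ]
      have ht : t ≤ 2 * s := by linarith
      have h0 : 0 ≤ t - s := by linarith
      calc (t - s) * t * ρ ≤ |u - v| * (2 * s) * (2 * s) := by
            have h5 : ρ ≤ 2 * s := by linarith
            have h6 : 0 ≤ t := by linarith
            gcongr
        _ = _ := by ring
    calc _ ≤ C * (4 * (|u - v| / ρ)) := by gcongr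
      _ = _ := by ring
  rw [← heven u, ← heven v]
  obtain ⟨h2, h3⟩ := abs_le.1 h1
  rcases le_total |u| |v| with h | h
  · exact key _ _ (by linarith) h (by linarith)
  · rw [abs_sub_comm]
    exact key _ _ (by linarith) h (by linarith)

lemma extWord_snoc_lt (M : ℕ) (τ : Fin M → Bool) (b : Bool) (k : ℕ) (hk : k < M) :
    extWord (M + 1) (Fin.snoc (α := fun _ => Bool) τ b) k = extWord M τ k := by
  simp only [extWord, hk, dif_pos, show k < M + 1 by omega]
  simp [Fin.snoc, hk]

lemma extWord_snoc_last (M : ℕ) (τ : Fin M → Bool) (b : Bool) :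
    extWord (M + 1) (Fin.snoc (α := fun _ => Bool) τ b) M = b := by
  simp [extWord, Fin.snoc]

lemma fN_update (r : ℝ) (A : ℕ → (ℕ → Bool) → ℝ) (M : ℕ)
    (hdep : ∀ k < M, ∀ ε ε', (∀ j < k, ε j = ε' j) → A k ε = A k ε')
    (α : (Fin M → Bool) → ℝ) (τ : Fin M → Bool) (b : Bool) :
    fN r (Function.update A M fun ε => α fun i => ε i.1) (M + 1)
      (extWord (M + 1) (Fin.snoc (α := fun _ => Bool) τ b)) =
    fN r A M (extWord M τ) + α τ / 2 * r ^ M * sgn b := by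
  rw [fN_succ, extWord_snoc_last, Function.update_self]
  congr 1
  · apply fN_congr
    · intro k hk
      rw [Function.update_of_ne hk.ne]
      exact hdep k hk _ _ fun j hj => extWord_snoc_lt M τ b j (hj.trans hk)
    · intro k hk
      exact extWord_snoc_lt M τ b k hk
  · congr 4
    funext i
    rw [extWord_snoc_lt M τ b i.1 i.2]
    simp [extWord]

lemma sum_snoc (M : ℕ) (F : (Fin (M + 1) → Bool) → ℝ) (τ : Fin M → Bool) (b : Bool) :
    ∑ σ ∈ Finset.univ.erase (Fin.snoc (α := fun _ => Bool) τ b), F σ =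
      F (Fin.snoc (α := fun _ => Bool) τ (!b)) + ∑ τ' ∈ Finset.univ.erase τ,
        (F (Fin.snoc (α := fun _ => Bool) τ' true) + F (Fin.snoc (α := fun _ => Bool) τ' false)) := by
  rw [Finset.sum_erase_eq_sub (Finset.mem_univ _), Finset.sum_erase_eq_sub (Finset.mem_univ _)]
  have : ∑ σ : Fin (M + 1) → Bool, F σ = ∑ τ' : Fin M → Bool,
      (F (Fin.snoc (α := fun _ => Bool) τ' true) + F (Fin.snoc (α := fun _ => Bool) τ' false)) := by
    rw [← (Fin.snocEquiv fun _ => Bool).sum_comp, Fintype.sum_prod_type_right]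
    apply Finset.sum_congr rfl
    intro τ' _
    rw [Fintype.sum_bool]
    rfl
  rw [this]
  cases b <;> simp <;> ring

end Comb

section Main

lemma step_err (e : ℝ → ℝ) (heven : ∀ t, e |t| = e t) (C : ℝ) (hC0 : 0 ≤ C)
    (hC : ∀ s t : ℝ, 0 < s → s ≤ t → |e s - e t| ≤ C * ((t - s) * t / s ^ 2))
    (r : ℝ) (hr : 0 < r) (hr16 : r ≤ 1 / 16) (A : ℕ → (ℕ → Bool) → ℝ) (M : ℕ)
    (hA : ∀ k < M, ∀ ε, 1 ≤ A k ε ∧ A k ε ≤ 3)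
    (hdep : ∀ k < M, ∀ ε ε', (∀ j < k, ε j = ε' j) → A k ε = A k ε')
    (α : (Fin M → Bool) → ℝ) (hα : ∀ τ, 1 ≤ α τ ∧ α τ ≤ 3) (τ : Fin M → Bool) (b b' : Bool) :
    ∑ τ' ∈ Finset.univ.erase τ,
      |e ((fN r A M (extWord M τ) + α τ / 2 * r ^ M * sgn b) -
          (fN r A M (extWord M τ') + α τ' / 2 * r ^ M * sgn b')) -
        e (fN r A M (extWord M τ) - fN r A M (extWord M τ'))| ≤ 12 * C * (4 * r) := by
  apply sum_err r hr hr16 M τ (12 * C) (by positivity)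
  intro τ' j hlt hne
  have hsep := fN_sep r hr hr16 A M hA hdep (extWord M τ) (extWord M τ') j.1 j.2
    (fun i hi => by
      have := hlt ⟨i, hi.trans j.2⟩ hi
      simpa [extWord, hi.trans j.2] using this)
    (by simpa [extWord] using hne)
  have hrM : 0 < r ^ M := by positivity
  have hb : ∀ τ b, |α τ / 2 * r ^ M * sgn b| ≤ 3 / 2 * r ^ M := by
    intro τ b
    have := hα τ
    rw [abs_mul, sgn_abs, mul_one, abs_of_nonneg (by
      have : 0 ≤ α τ := by linarith
      positivity)]
    gcongr
    linarith
  have h1 := hb τ b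
  have h2 := hb τ' b'
  set x := fN r A M (extWord M τ)
  set y := fN r A M (extWord M τ')
  set p := α τ / 2 * r ^ M * sgn b
  set q := α τ' / 2 * r ^ M * sgn b'
  have h3 : |(x - y) - ((x + p) - (y + q))| ≤ 3 * r ^ M := by
    rw [show (x - y) - ((x + p) - (y + q)) = q - p by ring]
    have := abs_sub q p
    linarith
  have hj0 : 0 < r ^ j.1 := by positivity
  have hsplit : r ^ M = r ^ (M - j.1) * r ^ j.1 := by
    rw [← pow_add]; congr 1; omega
  have hle : r ^ (M - j.1) ≤ 1 / 16 := by
    obtain ⟨k, hk⟩ : ∃ k, M - j.1 = k + 1 := ⟨M - j.1 - 1, by omega⟩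
    rw [hk, pow_succ]
    have : r ^ k ≤ 1 := pow_le_one₀ hr.le (by linarith)
    nlinarith
  have h4 := e_perturb e heven C hC0 hC (x - y) ((x + p) - (y + q)) (r ^ j.1) hj0 hsep (by
    refine h3.trans ?_
    rw [hsplit]
    nlinarith)
  rw [abs_sub_comm]
  refine h4.trans ?_
  have h5 : |(x - y) - ((x + p) - (y + q))| / r ^ j.1 ≤ 3 * r ^ (M - j.1) := by
    rw [div_le_iff₀ hj0, mul_assoc, ← hsplit]
    exact h3
  calc _ ≤ 4 * C * (3 * r ^ (M - j.1)) := by gcongr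
    _ = _ := by ring

lemma step_gE (n : ℕ) (e₁ : EuclideanSpace ℝ (Fin (n - 1))) (C : ℝ) (hC0 : 0 ≤ C)
    (hC : ∀ s t : ℝ, 0 < s → s ≤ t → |eFun1 n e₁ s - eFun1 n e₁ t| ≤ C * ((t - s) * t / s ^ 2))
    (r : ℝ) (hr : 0 < r) (hr16 : r ≤ 1 / 16) (A : ℕ → (ℕ → Bool) → ℝ) (M : ℕ)
    (hA : ∀ k < M, ∀ ε, 1 ≤ A k ε ∧ A k ε ≤ 3)
    (hdep : ∀ k < M, ∀ ε ε', (∀ j < k, ε j = ε' j) → A k ε = A k ε')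
    (α : (Fin M → Bool) → ℝ) (hα : ∀ τ, 1 ≤ α τ ∧ α τ ≤ 3) (τ : Fin M → Bool) (b : Bool) :
    |2 ^ (M + 1) * gE n e₁ r (Function.update A M fun ε => α fun i => ε i.1) (M + 1)
        (Fin.snoc (α := fun _ => Bool) τ b) -
      (2 * (2 ^ M * gE n e₁ r A M τ) + eFun1 n e₁ (α τ * r ^ M))| ≤ 96 * C * r := by
  have hp : ∀ N : ℕ, ∀ z : ℝ, (2 : ℝ) ^ N * ((2 : ℝ)⁻¹ ^ N * z) = z := by
    intro N z
    rw [← mul_assoc, ← mul_pow]; simp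
  rw [gE, gE, hp, hp, sum_snoc]
  simp only [fN_update r A M hdep α]
  have hself : eFun1 n e₁ (fN r A M (extWord M τ) + α τ / 2 * r ^ M * sgn b -
      (fN r A M (extWord M τ) + α τ / 2 * r ^ M * sgn !b)) = eFun1 n e₁ (α τ * r ^ M) := by
    cases b
    · rw [← eFun1_neg]; congr 1; simp [sgn]; ring
    · congr 1; simp [sgn]; ring
  rw [hself, Finset.sum_add_distrib]
  have h1 := (Finset.abs_sum_le_sum_abs _ _).trans
    (step_err _ (eFun1_abs n e₁) C hC0 hC r hr hr16 A M hA hdep α hα τ b true)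
  have h2 := (Finset.abs_sum_le_sum_abs _ _).trans
    (step_err _ (eFun1_abs n e₁) C hC0 hC r hr hr16 A M hA hdep α hα τ b false)
  rw [Finset.sum_sub_distrib] at h1 h2
  rw [abs_le] at h1 h2 ⊢
  constructor <;> linarith [h1.1, h1.2, h2.1, h2.2]

lemma choose_alpha (e : ℝ → ℝ) (C : ℝ) (hC0 : 0 ≤ C)
    (hC : ∀ s t : ℝ, 0 < s → s ≤ t → |e s - e t| ≤ C * ((t - s) * t / s ^ 2))
    (a : ℝ) (ha : 1 < a) (t : ℝ) (ht : 0 < t) (v : ℝ) (hv0 : 0 ≤ v) (hv : v ≤ e t - e (a * t)) :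
    ∃ α : ℝ, 1 ≤ α ∧ α ≤ a ∧ e (α * t) = e t - v := by
  have key : ∀ x y : ℝ, 1 ≤ x → x ≤ y → y ≤ a → |e (x * t) - e (y * t)| ≤ C * a * |x - y| := by
    intro x y hx hxy hy
    refine (hC (x * t) (y * t) (by positivity) (by gcongr)).trans ?_
    rw [mul_assoc]
    gcongr
    rw [div_le_iff₀ (by positivity), abs_sub_comm, abs_of_nonneg (by linarith)]
    have h0 : 0 ≤ y - x := by linarith
    have : (y * t - x * t) * (y * t) = y * (y - x) * t ^ 2 * 1 := by ring
    rw [this]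
    calc y * (y - x) * t ^ 2 * 1 ≤ a * (y - x) * t ^ 2 * x ^ 2 := by
          gcongr
          nlinarith
      _ = _ := by ring
  have hcont : ContinuousOn (fun x => e (x * t)) (Set.Icc 1 a) := by
    have : LipschitzOnWith (Real.toNNReal (C * a)) (fun x => e (x * t)) (Set.Icc 1 a) := by
      apply LipschitzOnWith.of_dist_le_mul
      intro x hx y hy
      rw [Real.coe_toNNReal _ (by positivity), Real.dist_eq, Real.dist_eq]
      rcases le_total x y with h | h
      · exact key x y hx.1 h hy.2
      · rw [abs_sub_comm, abs_sub_comm x y]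
        exact key y x hy.1 h hx.2
    exact this.continuousOn
  have := intermediate_value_Icc' ha.le hcont
  obtain ⟨α, hα, h⟩ := this (show e t - v ∈ Set.Icc _ _ from ⟨by linarith, by simp; linarith⟩)
  exact ⟨α, hα.1, hα.2, h⟩

end Main

/-- the key lemma in `ℝⁿ`, `n ≥ 3`. For `a ∈ (2,3]` there are `A > 0` and
`r₀ ∈ (0,1/16]` such that for every `r ∈ (0,r₀]` and `m ≥ 1`: if the coefficients
`a_k ∈ [1,a]` (depending only on the first `k` letters, `a_0 ≡ 1`) have been chosen for
`k ≤ m−2` and `c_{m−1} ≤ g̃_{m−1} ≤ c_{m−1} + 2^{−(m−1)} A` on `K_{m−1}`, then one can choose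
`a_{m−1} : {−1,1}^{m−1} → [1,a]` so that for some constant `c_m`,
`c_m ≤ g̃_m ≤ c_m + 2^{−m} A` on `K_m`. -/
theorem stmt19 (n : ℕ) (hn : 3 ≤ n)
    (e₁ : EuclideanSpace ℝ (Fin (n - 1))) (he₁ : ‖e₁‖ = 1)
    (a : ℝ) (ha2 : 2 < a) (ha3 : a ≤ 3) :
    ∃ A₀ r₀ : ℝ, 0 < A₀ ∧ 0 < r₀ ∧ r₀ ≤ 1 / 16 ∧
      ∀ r : ℝ, 0 < r → r ≤ r₀ →
      ∀ m : ℕ, 1 ≤ m →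
      ∀ A : ℕ → (ℕ → Bool) → ℝ,
        (∀ ε, 2 ≤ m → A 0 ε = 1) →
        (∀ k, k + 2 ≤ m → ∀ ε, 1 ≤ A k ε ∧ A k ε ≤ a) →
        (∀ k, k + 2 ≤ m → ∀ ε ε', (∀ j < k, ε j = ε' j) → A k ε = A k ε') →
      ∀ c : ℝ,
        (∀ σ : Fin (m - 1) → Bool,
          c ≤ gE n e₁ r A (m - 1) σ ∧
          gE n e₁ r A (m - 1) σ ≤ c + (2 : ℝ)⁻¹ ^ (m - 1) * A₀) →
      ∃ A' : (ℕ → Bool) → ℝ,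
        (∀ ε, 1 ≤ A' ε ∧ A' ε ≤ a) ∧
        (∀ ε ε', (∀ j < m - 1, ε j = ε' j) → A' ε = A' ε') ∧
        ∃ c' : ℝ,
          ∀ σ : Fin m → Bool,
            c' ≤ gE n e₁ r (Function.update A (m - 1) A') m σ ∧
            gE n e₁ r (Function.update A (m - 1) A') m σ ≤ c' + (2 : ℝ)⁻¹ ^ m * A₀ := by
  by_cases hsph : sphC n = 0
  · have h0 : ∀ r A m σ, gE n e₁ r A m σ = 0 := by
      intro r A m σ
      simp [gE, eFun1, hsph]
    refine ⟨1, 1 / 16, by norm_num, by norm_num, le_rfl, ?_⟩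
    intro r hr hr0 m hm A _ _ _ c _
    refine ⟨fun _ => 1, fun _ => ⟨le_rfl, by linarith⟩, fun _ _ _ => rfl, 0, fun σ => ?_⟩
    rw [h0]
    exact ⟨le_rfl, by positivity⟩
  have ha : 1 < a := by linarith
  obtain ⟨⟨C, hC0, hC⟩, D, hD0, hD⟩ := eFun1_bounds n hn e₁ he₁ hsph a ha
  refine ⟨D / 2, min (1 / 16) (D / 2 / (192 * C + 1)), by positivity, by positivity,
    min_le_left _ _, ?_⟩
  intro r hr hr0 m hm A _ hA hdep c hc
  have hr16 : r ≤ 1 / 16 := hr0.trans (min_le_left _ _)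
  have hrD : 192 * C * r ≤ D / 2 := by
    have := hr0.trans (min_le_right _ _)
    rw [le_div_iff₀ (by positivity)] at this
    linarith
  obtain ⟨M, rfl⟩ : ∃ M, m = M + 1 := ⟨m - 1, by omega⟩
  simp only [Nat.add_sub_cancel] at hc ⊢
  change ∀ σ : Fin M → Bool, c ≤ gE n e₁ r A M σ ∧
    gE n e₁ r A M σ ≤ c + (2 : ℝ)⁻¹ ^ M * (D / 2) at hc
  have hrM : 0 < r ^ M := by positivity
  have hrM1 : r ^ M ≤ 1 := pow_le_one₀ hr.le (by linarith)
  have hpow : (2 : ℝ) ^ M * (2 : ℝ)⁻¹ ^ M = 1 := by rw [← mul_pow]; simp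
  have hpow1 : (2 : ℝ)⁻¹ ^ (M + 1) * (2 : ℝ) ^ (M + 1) = 1 := by rw [← mul_pow]; simp
  have h2M : (0 : ℝ) < 2 ^ M := by positivity
  have hex : ∀ τ : Fin M → Bool, ∃ α : ℝ, 1 ≤ α ∧ α ≤ a ∧
      eFun1 n e₁ (α * r ^ M) = eFun1 n e₁ (r ^ M) - 2 * (2 ^ M * (gE n e₁ r A M τ - c)) := by
    intro τ
    obtain ⟨hc1, hc2⟩ := hc τ
    apply choose_alpha _ C hC0 hC a ha _ hrM
    · have : 0 ≤ gE n e₁ r A M τ - c := by linarith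
      positivity
    · have h1 : 2 ^ M * (gE n e₁ r A M τ - c) ≤ 2 ^ M * ((2 : ℝ)⁻¹ ^ M * (D / 2)) := by
        gcongr
        linarith
      rw [← mul_assoc, hpow] at h1
      have := hD _ hrM hrM1
      linarith
  choose α hα1 hαa hα using hex
  have hstep := step_gE n e₁ C hC0 hC r hr hr16 A M
    (fun k hk ε => ⟨(hA k (by omega) ε).1, (hA k (by omega) ε).2.trans ha3⟩)
    (fun k hk => hdep k (by omega)) α (fun τ => ⟨hα1 τ, (hαa τ).trans ha3⟩)
  refine ⟨fun ε => α fun i => ε i.1, fun ε => ⟨hα1 _, hαa _⟩, ?_,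
    (2 : ℝ)⁻¹ ^ (M + 1) * (2 * (2 ^ M * c) + eFun1 n e₁ (r ^ M) - 96 * C * r), ?_⟩
  · intro ε ε' h
    have : (fun i : Fin M => ε i.1) = fun i : Fin M => ε' i.1 := funext fun i => h i.1 i.2
    simp only [this]
  · intro σ
    obtain ⟨τ, b, rfl⟩ : ∃ (τ : Fin M → Bool) (b : Bool),
        σ = Fin.snoc (α := fun _ => Bool) τ b := ⟨Fin.init σ, σ (Fin.last M), by simp⟩
    have h := hstep τ b
    rw [hα τ, abs_le] at h
    set G := gE n e₁ r (Function.update A M fun ε => α fun i => ε i.1) (M + 1)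
        (Fin.snoc (α := fun _ => Bool) τ b)
    have hG : G = (2 : ℝ)⁻¹ ^ (M + 1) * (2 ^ (M + 1) * G) := by
      rw [← mul_assoc, hpow1, one_mul]
    rw [hG, ← mul_add]
    constructor
    · apply mul_le_mul_of_nonneg_left _ (by positivity)
      linarith [h.1]
    · apply mul_le_mul_of_nonneg_left _ (by positivity)
      linarith [h.2]

end
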